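/- arXiv:math/0610532 — 3 statements merged into one kernel-verified Lean document; each statement's English description precedes it below -/
import Mathlib

section
/- Let E ⊆ ℂ^m be an m-dimensional ℝ-linear subspace that is Lagrangian, i.e. Im⟪v, w⟫ = 0 for all v, w ∈ E. Then there exists a unitary transformation U of ℂ^m with U(ℝ^m) = E, where ℝ^m ⊂ ℂ^m is the set of vectors with all coordinates real. If moreover E admits a basis e₁, …, e_m orthonormal for Re⟪·,·⟫ with Ψ₀(e₁, …, e_m) = 1, then U may be chosen to be special unitary (det U = 1). (Harvey–Lawson: an m-plane is calibrated by Re Ψ₀ if and only if it is the image of ℝ^m under an element of SU(m).) -/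
/-- The Hermitian inner product `⟪v, w⟫ = Σₖ conj(vₖ)·wₖ` on ℂ^m. -/
noncomputable def herm {m : ℕ} (v w : Fin m → ℂ) : ℂ := ∑ k, (starRingEnd ℂ) (v k) * w k

/-- The ℝ-subspace `ℝ^m ⊂ ℂ^m` of vectors with all coordinates real. -/
noncomputable def realVectors (m : ℕ) : Submodule ℝ (Fin m → ℂ) :=
  LinearMap.range (LinearMap.pi fun i : Fin m =>
    Complex.ofRealAm.toLinearMap.comp (LinearMap.proj i))

theorem herm_eq_star_dotProduct {m : ℕ} (v w : Fin m → ℂ) : herm v w = star v ⬝ᵥ w := rfl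

theorem finrank_realVectors (m : ℕ) : Module.finrank ℝ (realVectors m) = m := by
  rw [realVectors, LinearMap.finrank_range_of_inj, Module.finrank_fin_fun]
  intro x y h
  funext i
  simpa using congrFun h i

/-- A Hermitian-orthonormal family in an `m`-dimensional real subspace `E` yields a unitary map
whose matrix has this family as its columns and which sends `ℝ^m` onto `E`. -/
theorem exists_unitary_map_realVectors_eq {m : ℕ} {E : Submodule ℝ (Fin m → ℂ)}
    (hdim : Module.finrank ℝ E = m) {e : Fin m → Fin m → ℂ} (he : ∀ a, e a ∈ E)
    (horth : ∀ a b, herm (e a) (e b) = if a = b then 1 else 0) :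
    ∃ U : (Fin m → ℂ) ≃ₗ[ℂ] (Fin m → ℂ),
      (∀ v w, herm (U v) (U w) = herm v w) ∧
      LinearMap.det U.toLinearMap = (Matrix.of fun i a => e a i).det ∧
      Submodule.map (U.toLinearMap.restrictScalars ℝ) (realVectors m) = E := by
  set M : Matrix (Fin m) (Fin m) ℂ := Matrix.of fun i a => e a i with hM
  have hMM : M.conjTranspose * M = 1 := by
    ext a b
    rw [Matrix.one_apply, ← horth a b]
    rfl
  refine ⟨Matrix.toLin'OfInv hMM (mul_eq_one_comm.mp hMM), fun v w => ?_, ?_, ?_⟩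
  · change herm (M.mulVec v) (M.mulVec w) = herm v w
    rw [herm_eq_star_dotProduct, herm_eq_star_dotProduct, Matrix.star_mulVec,
      Matrix.dotProduct_mulVec, Matrix.vecMul_vecMul, hMM, Matrix.vecMul_one]
  · exact LinearMap.det_toLin' M
  · refine Submodule.eq_of_le_of_finrank_eq ?_ ?_
    · rintro _ ⟨_, ⟨x, rfl⟩, rfl⟩
      have hsum : M.mulVec (fun i => (x i : ℂ)) = ∑ a, x a • e a := by
        funext i
        simp [hM, Matrix.mulVec, dotProduct, Finset.sum_apply, mul_comm]
      change M.mulVec (fun i => (x i : ℂ)) ∈ E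
      rw [hsum]
      exact E.sum_mem fun a _ => E.smul_mem _ (he a)
    · rw [hdim]
      exact (LinearEquiv.finrank_map_eq (LinearEquiv.restrictScalars ℝ _) _).trans
        (finrank_realVectors m)

/-- Every real subspace of `ℂ^m` of dimension `m` has a basis orthonormal for `Re⟪·,·⟫`. -/
theorem exists_re_herm_orthonormal {m : ℕ} {E : Submodule ℝ (Fin m → ℂ)}
    (hdim : Module.finrank ℝ E = m) :
    ∃ e : Fin m → Fin m → ℂ, (∀ a, e a ∈ E) ∧
      ∀ a b, (herm (e a) (e b)).re = if a = b then 1 else 0 := by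
  let L := (WithLp.linearEquiv 2 ℝ (Fin m → ℂ)).symm
  let F : Submodule ℝ (EuclideanSpace ℂ (Fin m)) := E.map L.toLinearMap
  have hF : Module.finrank ℝ F = m := (L.finrank_map_eq E).trans hdim
  let b : OrthonormalBasis (Fin m) ℝ F := (stdOrthonormalBasis ℝ F).reindex (finCongr hF)
  refine ⟨fun a => L.symm (b a), fun a => ?_, fun a c => ?_⟩
  · obtain ⟨x, hx, hxa⟩ := (b a).2
    change L.symm (b a) ∈ E
    rw [← hxa]
    simpa using hx
  · rw [← orthonormal_iff_ite.mp b.orthonormal a c, Submodule.coe_inner, PiLp.inner_apply,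
      herm, Complex.re_sum]
    refine Finset.sum_congr rfl fun k _ => ?_
    simp [L, Complex.inner, mul_comm]

/-- Harvey–Lawson: a Lagrangian `m`-plane `E ⊆ ℂ^m` is the image of `ℝ^m` under a
unitary transformation; if moreover `E` has a real-orthonormal basis `e` with
`Ψ₀(e₁, …, e_m) = 1`, the transformation may be chosen special unitary. -/
theorem lagrangian_plane_is_unitary_image_of_Rm (m : ℕ) (E : Submodule ℝ (Fin m → ℂ))
    (hdim : Module.finrank ℝ E = m)
    (hlag : ∀ v ∈ E, ∀ w ∈ E, (herm v w).im = 0) :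
    (∃ U : (Fin m → ℂ) ≃ₗ[ℂ] (Fin m → ℂ),
        (∀ v w, herm (U v) (U w) = herm v w) ∧
        Submodule.map (U.toLinearMap.restrictScalars ℝ) (realVectors m) = E) ∧
    (∀ e : Fin m → Fin m → ℂ, (∀ a, e a ∈ E) →
        (∀ a b, (herm (e a) (e b)).re = if a = b then 1 else 0) →
        (Matrix.of fun i a => e a i).det = 1 →
        ∃ U : (Fin m → ℂ) ≃ₗ[ℂ] (Fin m → ℂ),
          (∀ v w, herm (U v) (U w) = herm v w) ∧
          LinearMap.det U.toLinearMap = 1 ∧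
          Submodule.map (U.toLinearMap.restrictScalars ℝ) (realVectors m) = E) := by
  have horth : ∀ e : Fin m → Fin m → ℂ, (∀ a, e a ∈ E) →
      (∀ a b, (herm (e a) (e b)).re = if a = b then 1 else 0) →
      ∀ a b, herm (e a) (e b) = if a = b then 1 else 0 := by
    intro e he hre a b
    apply Complex.ext
    · rw [hre]; split_ifs <;> simp
    · rw [hlag _ (he a) _ (he b)]; split_ifs <;> simp
  constructor
  · obtain ⟨e, he, hre⟩ := exists_re_herm_orthonormal hdim
    obtain ⟨U, hU, -, hmap⟩ := exists_unitary_map_realVectors_eq hdim he (horth e he hre)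
    exact ⟨U, hU, hmap⟩
  · intro e he hre hdet
    obtain ⟨U, hU, hUdet, hmap⟩ := exists_unitary_map_realVectors_eq hdim he (horth e he hre)
    exact ⟨U, hU, hUdet.trans hdet, hmap⟩
end

section
/- Let u : ℂ³ → ℂ³ be an ℝ-linear bijection such that Im⟪u(v), u(w)⟫ = Im⟪v, w⟫ for all v, w ∈ ℂ³ (u preserves the standard Kähler 2-form Ω₀) and Re Ψ₀(u(v₁), u(v₂), u(v₃)) = Re Ψ₀(v₁, v₂, v₃) for all v₁, v₂, v₃ ∈ ℂ³ (u preserves the real part of the standard holomorphic volume form). Then u is ℂ-linear, unitary (⟪u(v), u(w)⟫ = ⟪v, w⟫ for all v, w), and its complex determinant equals 1. (The isotropy group in GL(6, ℝ) of the pair (Ω₀, Re Ψ₀) is SU(3).) -/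
/-- The Hermitian inner product `⟪v, w⟫ = Σₖ conj(vₖ)·wₖ` on ℂ³. -/
noncomputable def herm3 (v w : Fin 3 → ℂ) : ℂ := ∑ k, (starRingEnd ℂ) (v k) * w k

/-- `Ψ₀(v₁, v₂, v₃)`: the determinant of the 3×3 complex matrix with columns
`v₁, v₂, v₃` (the standard holomorphic volume form `dz₁∧dz₂∧dz₃`). -/
def Psi3 (v : Fin 3 → Fin 3 → ℂ) : ℂ := (Matrix.of fun i a => v a i).det

/-- A real-linear endomorphism of ℂ³ mapping every vector into its complex span is
multiplication by a complex scalar. -/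
theorem exists_smul_of_cross_eq_zero (A : (Fin 3 → ℂ) →ₗ[ℝ] (Fin 3 → ℂ))
    (hA : ∀ v i j, A v i * v j = A v j * v i) : ∃ c : ℂ, ∀ v, A v = c • v := by
  have polar : ∀ v w i j, A v i * w j + A w i * v j = A v j * w i + A w j * v i := by
    intro v w i j
    have h := hA (v + w) i j
    simp only [map_add, Pi.add_apply] at h
    linear_combination h - hA v i j - hA w i j
  have eigen : ∀ i j, i ≠ j → ∀ v, A v i = A (Pi.single j 1) j * v i := by
    intro i j hij v
    have h₁ := hA (Pi.single j 1) i j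
    have h₂ := polar v (Pi.single j 1) i j
    simp only [Pi.single_eq_same, Pi.single_eq_of_ne hij, mul_one, mul_zero] at h₁ h₂
    linear_combination h₂ - v j * h₁
  have h₀₁ := eigen 0 1 (by decide) (Pi.single 0 1)
  have h₀₂ := eigen 0 2 (by decide) (Pi.single 0 1)
  simp only [Pi.single_eq_same, mul_one] at h₀₁ h₀₂
  refine ⟨A (Pi.single 0 1) 0, fun v => funext fun i => ?_⟩
  fin_cases i
  · simpa [h₀₁] using eigen 0 1 (by decide) v
  · exact eigen 1 0 (by decide) v
  · exact eigen 2 0 (by decide) v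

theorem Psi3_eq (a b c : Fin 3 → ℂ) : Psi3 ![a, b, c] =
    (a 1 * b 2 - a 2 * b 1) * c 0 + (a 2 * b 0 - a 0 * b 2) * c 1
      + (a 0 * b 1 - a 1 * b 0) * c 2 := by
  simp only [Psi3, Matrix.det_fin_three, Matrix.of_apply, Matrix.cons_val]
  ring

theorem Psi3_smul_right (a b x : Fin 3 → ℂ) (c : ℂ) :
    Psi3 ![a, b, c • x] = c * Psi3 ![a, b, x] := by
  simp only [Psi3_eq, Pi.smul_apply, smul_eq_mul]
  ring

/-- If `Re Ψ₀(v, w, ·)` vanishes identically then `v` and `w` are linearly dependent over `ℂ`. -/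
theorem cross_eq_of_re_Psi3_eq_zero {v w : Fin 3 → ℂ}
    (h : ∀ x, (Psi3 ![v, w, x]).re = 0) (i j : Fin 3) : v i * w j = v j * w i := by
  have hc : ∀ x, Psi3 ![v, w, x] = 0 := by
    intro x
    refine Complex.ext (h x) ?_
    simpa [Psi3_smul_right] using h (Complex.I • x)
  have h₀ := hc (Pi.single 0 1)
  have h₁ := hc (Pi.single 1 1)
  have h₂ := hc (Pi.single 2 1)
  simp [Psi3_eq] at h₀ h₁ h₂
  fin_cases i <;> fin_cases j <;> simp only [Fin.zero_eta, Fin.mk_one, Fin.reduceFinMk] <;>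
    first
      | rfl
      | linear_combination h₀
      | linear_combination -h₀
      | linear_combination h₁
      | linear_combination -h₁
      | linear_combination h₂
      | linear_combination -h₂

theorem herm3_smul_right (c : ℂ) (v w : Fin 3 → ℂ) : herm3 v (c • w) = c * herm3 v w := by
  simp only [herm3, Pi.smul_apply, smul_eq_mul, Finset.mul_sum]
  exact Finset.sum_congr rfl fun _ _ => by ring

theorem herm3_self_re_nonneg (v : Fin 3 → ℂ) : 0 ≤ (herm3 v v).re := by
  rw [herm3, Complex.re_sum]
  refine Finset.sum_nonneg fun k _ => ?_
  rw [← Complex.normSq_eq_conj_mul_self, Complex.ofReal_re]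
  exact Complex.normSq_nonneg _

/-- An `ℝ`-linear bijection preserving `Re Ψ₀` commutes or anticommutes with multiplication
by `i`. -/
theorem commutes_or_anticommutes_I_of_re_Psi3 (u : (Fin 3 → ℂ) ≃ₗ[ℝ] (Fin 3 → ℂ))
    (hΨ : ∀ v₁ v₂ v₃ : Fin 3 → ℂ,
        (Psi3 ![u v₁, u v₂, u v₃]).re = (Psi3 ![v₁, v₂, v₃]).re) :
    (∀ v, u (Complex.I • v) = Complex.I • u v) ∨
      (∀ v, u (Complex.I • v) = -(Complex.I • u v)) := by
  let A : (Fin 3 → ℂ) →ₗ[ℝ] (Fin 3 → ℂ) :=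
    u.symm.toLinearMap ∘ₗ (Complex.I • LinearMap.id) ∘ₗ u.toLinearMap
  have hA : ∀ v, u (A v) = Complex.I • u v := fun v => by simp [A]
  obtain ⟨c, hc⟩ := exists_smul_of_cross_eq_zero A fun v =>
    cross_eq_of_re_Psi3_eq_zero fun x => by
      rw [← hΨ, hA]
      simp only [Psi3_eq, Pi.smul_apply, smul_eq_mul]
      rw [← Complex.zero_re]
      congr 1
      ring
  have hc' : ∀ v, u (c • v) = Complex.I • u v := fun v => by rw [← hc, hA]
  have hsq : c * c = -1 := by
    have h : u ((c * c) • Pi.single 0 1) = u (-Pi.single 0 1) := by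
      rw [mul_smul, hc', hc', smul_smul, Complex.I_mul_I, map_neg, neg_one_smul]
    simpa using congrFun (u.injective h) 0
  have hcases : (c - Complex.I) * (c + Complex.I) = 0 := by
    linear_combination hsq - Complex.I_mul_I
  rcases mul_eq_zero.mp hcases with h | h
  · left
    rw [sub_eq_zero.mp h] at hc'
    exact hc'
  · right
    intro v
    rw [← hc', eq_neg_of_add_eq_zero_left h, neg_smul, map_neg, neg_neg]

/-- An ℝ-linear bijection of ℂ³ preserving the Kähler form `Ω₀ = Im⟪·,·⟫` and
`Re Ψ₀` is ℂ-linear, unitary, and has complex determinant 1: the isotropy group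
of `(Ω₀, Re Ψ₀)` in GL(6, ℝ) is SU(3). -/
theorem isotropy_of_kahler_and_reholvol_is_SU3 (u : (Fin 3 → ℂ) ≃ₗ[ℝ] (Fin 3 → ℂ))
    (hΩ : ∀ v w : Fin 3 → ℂ, (herm3 (u v) (u w)).im = (herm3 v w).im)
    (hΨ : ∀ v₁ v₂ v₃ : Fin 3 → ℂ,
        (Psi3 ![u v₁, u v₂, u v₃]).re = (Psi3 ![v₁, v₂, v₃]).re) :
    (∀ (c : ℂ) (v : Fin 3 → ℂ), u (c • v) = c • u v) ∧
    (∀ v w : Fin 3 → ℂ, herm3 (u v) (u w) = herm3 v w) ∧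
    (Matrix.of fun i a => u (Pi.single a 1) i).det = 1 := by
  have hI : ∀ v, u (Complex.I • v) = Complex.I • u v := by
    refine (commutes_or_anticommutes_I_of_re_Psi3 u hΨ).resolve_right fun hanti => ?_
    have h := hΩ (Pi.single 0 1) (Complex.I • Pi.single 0 1)
    rw [hanti, ← neg_smul, herm3_smul_right, herm3_smul_right] at h
    have hpos := herm3_self_re_nonneg (u (Pi.single 0 1))
    have hone : herm3 (Pi.single 0 1) (Pi.single 0 1) = 1 := by
      simp [herm3, Fin.sum_univ_three]
    simp [hone] at h
    linarith
  have hlin : ∀ (c : ℂ) (v : Fin 3 → ℂ), u (c • v) = c • u v := by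
    intro c v
    have hdecomp : ∀ x : Fin 3 → ℂ, c • x = c.re • x + c.im • Complex.I • x := by
      intro x
      funext k
      simp only [Pi.smul_apply, Pi.add_apply, smul_eq_mul, Complex.real_smul]
      linear_combination -(x k) * Complex.re_add_im c
    rw [hdecomp, hdecomp, map_add, map_smul, map_smul, hI]
  refine ⟨hlin, fun v w => Complex.ext ?_ (hΩ v w), ?_⟩
  · have h := hΩ v (Complex.I • w)
    rw [hI, herm3_smul_right, herm3_smul_right] at h
    simpa using h
  · have hdet : (Matrix.of fun i a => u (Pi.single a 1) i).det =
        Psi3 ![u (Pi.single 0 1), u (Pi.single 1 1), u (Pi.single 2 1)] := by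
      simp only [Psi3, Matrix.det_fin_three, Matrix.of_apply, Matrix.cons_val]
    have hre := hΨ (Pi.single 0 1) (Pi.single 1 1) (Pi.single 2 1)
    have him := hΨ (Pi.single 0 1) (Pi.single 1 1) (Complex.I • Pi.single 2 1)
    have hone : Psi3 ![Pi.single 0 1, Pi.single 1 1, Pi.single 2 1] = 1 := by
      simp [Psi3_eq]
    rw [hI, Psi3_smul_right, Psi3_smul_right, hone] at him
    rw [hone] at hre
    rw [hdet]
    exact Complex.ext hre (by simpa using him)
end

section
/- For nonzero x ∈ ℝ⁴ let v(x) = (x₁ + x₂·j, x₃ + x₄·j) ∈ ℍ². For nonzero x, y ∈ ℝ⁴, the right quaternionic lines coincide, v(x)·ℍ = v(y)·ℍ, if and only if there exists a nonzero complex number c with (y₁ + y₂·i, y₃ + y₄·i) = (c·(x₁ + x₂·i), c·(x₃ + x₄·i)) in ℂ². (Thus the twistor map restricted to ℝℙ³ ⊂ ℂℙ³ has image a ℂℙ¹ in ℍℙ¹ and its fibers are circles — the Hopf fibration.) -/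
/-- The map `v : ℝ⁴ → ℍ²`, `v(x) = (x₁ + x₂·j, x₃ + x₄·j)`. -/
def vq (x : Fin 4 → ℝ) : Quaternion ℝ × Quaternion ℝ :=
  (⟨x 0, 0, x 1, 0⟩, ⟨x 2, 0, x 3, 0⟩)

/-- The right quaternionic line spanned by `v ∈ ℍ²`. -/
def qline (v : Quaternion ℝ × Quaternion ℝ) : Set (Quaternion ℝ × Quaternion ℝ) :=
  {p | ∃ q : Quaternion ℝ, p = (v.1 * q, v.2 * q)}

/-- Multiplying a vector on the right by a nonzero quaternion does not change its line. -/
theorem qline_mul_right (v : Quaternion ℝ × Quaternion ℝ) {q : Quaternion ℝ} (hq : q ≠ 0) :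
    qline (v.1 * q, v.2 * q) = qline v := by
  ext p
  constructor
  · rintro ⟨r, rfl⟩
    exact ⟨q * r, by simp only [mul_assoc]⟩
  · rintro ⟨r, rfl⟩
    exact ⟨q⁻¹ * r, by simp only [mul_assoc, mul_inv_cancel_left₀ hq]⟩

/-- For nonzero `x, y ∈ ℝ⁴`, the right quaternionic lines of `v(x) = (x₁ + x₂·j, x₃ + x₄·j)`
and `v(y)` coincide iff `(y₁ + y₂·i, y₃ + y₄·i)` is a nonzero complex multiple of
`(x₁ + x₂·i, x₃ + x₄·i)` in ℂ²: the twistor map restricted to ℝℙ³ is the Hopf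
fibration over a ℂℙ¹ ⊂ ℍℙ¹. -/
theorem qline_eq_iff_complex_multiple (x y : Fin 4 → ℝ) (hx : x ≠ 0) (hy : y ≠ 0) :
    qline (vq x) = qline (vq y) ↔
      ∃ c : ℂ, c ≠ 0 ∧
        (⟨y 0, y 1⟩ : ℂ) = c * ⟨x 0, x 1⟩ ∧ (⟨y 2, y 3⟩ : ℂ) = c * ⟨x 2, x 3⟩ := by
  constructor
  · intro h
    have hmem : vq y ∈ qline (vq x) := h ▸ ⟨1, by simp⟩
    obtain ⟨q, hq⟩ := hmem
    obtain ⟨h₁, h₂⟩ := Prod.ext_iff.mp hq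
    have e₀ := congrArg QuaternionAlgebra.re h₁
    have e₁ := congrArg QuaternionAlgebra.imJ h₁
    have e₂ := congrArg QuaternionAlgebra.re h₂
    have e₃ := congrArg QuaternionAlgebra.imJ h₂
    rw [Quaternion.re_mul] at e₀ e₂
    rw [Quaternion.imJ_mul] at e₁ e₃
    simp only [vq] at e₀ e₁ e₂ e₃
    have c₁ : (⟨y 0, y 1⟩ : ℂ) = ⟨q.re, q.imJ⟩ * ⟨x 0, x 1⟩ := by
      apply Complex.ext <;> simp only [Complex.mul_re, Complex.mul_im] <;> linarith
    have c₂ : (⟨y 2, y 3⟩ : ℂ) = ⟨q.re, q.imJ⟩ * ⟨x 2, x 3⟩ := by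
      apply Complex.ext <;> simp only [Complex.mul_re, Complex.mul_im] <;> linarith
    refine ⟨⟨q.re, q.imJ⟩, fun hc => hy ?_, c₁, c₂⟩
    rw [hc, zero_mul] at c₁ c₂
    funext i
    fin_cases i
    exacts [congrArg Complex.re c₁, congrArg Complex.im c₁,
      congrArg Complex.re c₂, congrArg Complex.im c₂]
  · rintro ⟨c, hc, h₁, h₂⟩
    obtain ⟨q, hre, hI, hJ, hK⟩ : ∃ q : Quaternion ℝ,
        q.re = c.re ∧ q.imI = 0 ∧ q.imJ = c.im ∧ q.imK = 0 :=
      ⟨⟨c.re, 0, c.im, 0⟩, rfl, rfl, rfl, rfl⟩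
    have hq : q ≠ 0 := by
      rintro rfl
      exact hc (Complex.ext hre.symm hJ.symm)
    rw [← qline_mul_right (vq x) hq]
    obtain ⟨e₀, e₁⟩ := Complex.ext_iff.mp h₁
    obtain ⟨e₂, e₃⟩ := Complex.ext_iff.mp h₂
    simp only [Complex.mul_re, Complex.mul_im] at e₀ e₁ e₂ e₃
    congr 1
    refine Prod.ext (Quaternion.ext _ _ ?_ ?_ ?_ ?_) (Quaternion.ext _ _ ?_ ?_ ?_ ?_) <;>
      simp only [Quaternion.re_mul, Quaternion.imI_mul, Quaternion.imJ_mul,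
        Quaternion.imK_mul, hre, hI, hJ, hK] <;>
      simp only [vq] <;> linarith
end
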